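/- arXiv:1406.5378 — 2 statements merged into one kernel-verified Lean document; each statement's English description precedes it below -/
import Mathlib

section
/- Let c ∈ ℝ⟨⟨X⟩⟩ and write its unique decomposition c = (c, ∅)∅ + Σ_{i=0}^m x_i c^i, where c^i ∈ ℝ⟨⟨X⟩⟩ are the left quotients of c by the letters x_i. Then for any d ∈ ℝ^m⟨⟨X⟩⟩: c ∘̃ d = (c, ∅)∅ + Σ_{j=1}^m x_j (c^j ∘̃ d) + x_0 ( c^0 ∘̃ d + Σ_{j=1}^m d_j ⧢ (c^j ∘̃ d) ). In particular, (c ∘̃ d, ∅) = (c, ∅), and for any j ∈ {1, …, m} and any word η, (c ∘̃ d, x_j η) = (c^j ∘̃ d, η). -/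
open scoped BigOperators

/-- A word over the alphabet `X = {x_0, x_1, …, x_m}`. -/
abbrev Word (m : ℕ) := List (Fin (m+1))

/-- A formal power series in `ℝ⟨⟨X⟩⟩`. -/
abbrev Series (m : ℕ) := Word m → ℝ

/-- A formal power series in `ℝ^l⟨⟨X⟩⟩`. -/
abbrev SeriesVec (l m : ℕ) := Fin l → Series m

/-- The shuffle product on `ℝ⟨⟨X⟩⟩`, defined via the coefficient recursion
`(c ⧢ d, x_i η) = (c^{x_i} ⧢ d, η) + (c ⧢ d^{x_i}, η)` which is the bilinear
extension of `(x_i η) ⧢ (x_j ξ) = x_i (η ⧢ (x_j ξ)) + x_j ((x_i η) ⧢ ξ)`. -/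
def shuffle {m : ℕ} : Series m → Series m → Series m
  | c, d, [] => c [] * d []
  | c, d, i :: η => shuffle (fun w => c (i :: w)) d η + shuffle c (fun w => d (i :: w)) η

/-- `x_ℓ c` : prepend the letter `x_ℓ` to every word of `c`. -/
def prepend {m : ℕ} (ℓ : Fin (m+1)) (c : Series m) : Series m
  | [] => 0
  | j :: w => if j = ℓ then c w else 0

/-- The left quotient `c^{x_ℓ}` : `(c^{x_ℓ}, η) = (c, x_ℓ η)`. -/
def leftQuot {m : ℕ} (ℓ : Fin (m+1)) (c : Series m) : Series m :=
  fun w => c (ℓ :: w)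

/-- The series `1∅`. -/
def oneSeries {m : ℕ} : Series m := fun w => if w = [] then 1 else 0

/-- The constant series `K∅`. -/
def constSeries {m : ℕ} (K : ℝ) : Series m := fun w => if w = [] then K else 0

/-- The component `d_ℓ` of `d ∈ ℝ^m⟨⟨X⟩⟩` indexed by letters, with `d_0 := 0`. -/
def dhat {m : ℕ} (d : Fin m → Series m) (ℓ : Fin (m+1)) : Series m :=
  Fin.cases (motive := fun _ => Series m) 0 d ℓ

/-- The component `d_ℓ` of `d ∈ ℝ^m⟨⟨X⟩⟩` indexed by letters, with `d_0 := 1`. -/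
def dtil {m : ℕ} (d : Fin m → Series m) (ℓ : Fin (m+1)) : Series m :=
  Fin.cases (motive := fun _ => Series m) oneSeries d ℓ

/-- `φ_d(x_ℓ)(e) = x_ℓ e + x_0 (d_ℓ ⧢ e)` with `d_0 := 0`. -/
def phiLetter {m : ℕ} (d : Fin m → Series m) (ℓ : Fin (m+1)) (e : Series m) : Series m :=
  prepend ℓ e + prepend 0 (shuffle (dhat d ℓ) e)

/-- `φ_d(η)` for a word `η`, with `φ_d(∅) = id` and `φ_d(x_ℓ η) = φ_d(x_ℓ) ∘ φ_d(η)`. -/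
def phi {m : ℕ} (d : Fin m → Series m) : Word m → Series m → Series m
  | [], e => e
  | ℓ :: η, e => phiLetter d ℓ (phi d η e)

/-- The modified composition product `c ∘̃ d = Σ_{η ∈ X*} (c, η) φ_d(η)(1)`.
Since `φ_d(η)(1)` has no words of length `< |η|`, the coefficient of a word `ν`
is given by the (finite) sum over all words `η` with `|η| ≤ |ν|`. -/
def modComp {m : ℕ} (c : Series m) (d : Fin m → Series m) : Series m :=
  fun ν => ∑ k ∈ Finset.range (ν.length + 1), ∑ η : Fin k → Fin (m+1),
    c (List.ofFn η) * phi d (List.ofFn η) oneSeries ν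

/-- The modified composition product on `ℝ^l⟨⟨X⟩⟩`, componentwise. -/
def modCompVec {l m : ℕ} (c : SeriesVec l m) (d : SeriesVec m m) : SeriesVec l m :=
  fun i => modComp (c i) d

/-- `ψ_d(x_ℓ)(e) = x_0 (d_ℓ ⧢ e)` with `d_0 := 1`. -/
def psiLetter {m : ℕ} (d : Fin m → Series m) (ℓ : Fin (m+1)) (e : Series m) : Series m :=
  prepend 0 (shuffle (dtil d ℓ) e)

/-- `ψ_d(η)` for a word `η`, with `ψ_d(∅) = id` and `ψ_d(x_ℓ η) = ψ_d(x_ℓ) ∘ ψ_d(η)`. -/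
def psi {m : ℕ} (d : Fin m → Series m) : Word m → Series m → Series m
  | [], e => e
  | ℓ :: η, e => psiLetter d ℓ (psi d η e)

/-- The composition product `c ∘ d = Σ_{η ∈ X*} (c, η) ψ_d(η)(1)`. -/
def comp {m : ℕ} (c : Series m) (d : Fin m → Series m) : Series m :=
  fun ν => ∑ k ∈ Finset.range (ν.length + 1), ∑ η : Fin k → Fin (m+1),
    c (List.ofFn η) * psi d (List.ofFn η) oneSeries ν

/-- The composition product on `ℝ^l⟨⟨X⟩⟩`, componentwise. -/
def compVec {l m : ℕ} (c : SeriesVec l m) (d : SeriesVec m m) : SeriesVec l m :=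
  fun i => comp (c i) d

/-- The group product `c ⊚ d := d + c ∘̃ d` of the output feedback group,
so that `(δ + c) ∘ (δ + d) = δ + c ⊚ d`. -/
def oplus {m : ℕ} (c d : SeriesVec m m) : SeriesVec m m :=
  d + modCompVec c d

theorem shuffle_add_right {m : ℕ} (c e f : Series m) :
    shuffle c (e + f) = shuffle c e + shuffle c f := by
  funext ν
  induction ν generalizing c e f with
  | nil => simp [shuffle, mul_add]
  | cons i w ih =>
    have h := ih c (fun w => e (i :: w)) (fun w => f (i :: w))
    have h' := ih (fun w => c (i :: w)) e f
    simp only [Pi.add_apply] at h h'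
    change shuffle _ _ w + shuffle c ((fun w => e (i :: w)) + fun w => f (i :: w)) w =
      (shuffle _ _ w + shuffle _ _ w) + (shuffle _ _ w + shuffle _ _ w)
    rw [h, h']
    ring

theorem shuffle_smul_right {m : ℕ} (r : ℝ) (c e : Series m) :
    shuffle c (r • e) = r • shuffle c e := by
  funext ν
  induction ν generalizing c e with
  | nil => simp [shuffle, mul_left_comm]
  | cons i w ih =>
    have h := ih c (fun w => e (i :: w))
    have h' := ih (fun w => c (i :: w)) e
    simp only [Pi.smul_apply, smul_eq_mul] at h h'
    change shuffle _ _ w + shuffle c (r • fun w => e (i :: w)) w =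
      r * (shuffle _ _ w + shuffle _ _ w)
    rw [h, h']
    ring

theorem shuffle_zero_left {m : ℕ} (e : Series m) : shuffle 0 e = 0 := by
  funext ν
  induction ν generalizing e with
  | nil => simp [shuffle]
  | cons i w ih =>
    change shuffle 0 e w + shuffle 0 _ w = 0
    simp [ih]

/-- A coefficient of a shuffle product depends only on coefficients of words that are no longer. -/
theorem shuffle_congr_right {m : ℕ} (c : Series m) {e f : Series m} {ν : Word m}
    (h : ∀ u : Word m, u.length ≤ ν.length → e u = f u) : shuffle c e ν = shuffle c f ν := by
  induction ν generalizing c e f with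
  | nil => simp [shuffle, h []]
  | cons i w ih =>
    simp only [shuffle]
    rw [ih _ fun u hu => h u (by simp; omega),
      ih c (e := fun w => e (i :: w)) fun u hu => h (i :: u) (by simpa using hu)]

theorem phiLetter_apply_nil {m : ℕ} (d : Fin m → Series m) (i : Fin (m + 1)) (e : Series m) :
    phiLetter d i e [] = 0 := by
  simp [phiLetter, prepend]

theorem phiLetter_congr {m : ℕ} (d : Fin m → Series m) (i j : Fin (m + 1)) {e f : Series m}
    {w : Word m} (h : ∀ u : Word m, u.length ≤ w.length → e u = f u) :
    phiLetter d i e (j :: w) = phiLetter d i f (j :: w) := by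
  simp only [phiLetter, Pi.add_apply, prepend]
  rw [h w le_rfl, shuffle_congr_right _ h]

/-- `φ_d(x_i)` as a linear map. -/
def phiLetterLinear {m : ℕ} (d : Fin m → Series m) (i : Fin (m + 1)) : Series m →ₗ[ℝ] Series m where
  toFun := phiLetter d i
  map_add' e f := by
    funext ν
    cases ν with
    | nil => simp [phiLetter_apply_nil]
    | cons j w =>
      simp only [phiLetter, Pi.add_apply, prepend, shuffle_add_right]
      split_ifs <;> ring
  map_smul' r e := by
    funext ν
    cases ν with
    | nil => simp [phiLetter_apply_nil]
    | cons j w => simp [phiLetter, prepend, shuffle_smul_right, mul_add]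

theorem phiLetterLinear_apply {m : ℕ} (d : Fin m → Series m) (i : Fin (m + 1)) (e : Series m) :
    phiLetterLinear d i e = phiLetter d i e := rfl

theorem phi_apply_eq_zero {m : ℕ} (d : Fin m → Series m) (e : Series m) {η ν : Word m}
    (h : ν.length < η.length) : phi d η e ν = 0 := by
  induction η generalizing ν with
  | nil => simp at h
  | cons i η ih =>
    cases ν with
    | nil => exact phiLetter_apply_nil d i _
    | cons j w =>
      have hw : w.length < η.length := by simpa using h
      calc phiLetter d i (phi d η e) (j :: w) = phiLetter d i 0 (j :: w) :=
            phiLetter_congr d i j fun u hu => ih (hu.trans_lt hw)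
        _ = 0 := by rw [← phiLetterLinear_apply, map_zero]; rfl

/-- The part of `c ∘̃ d` coming from the words of `c` of length `k`. -/
noncomputable def modCompHomogeneous {m : ℕ} (c : Series m) (d : Fin m → Series m) (k : ℕ) :
    Series m :=
  ∑ η : Fin k → Fin (m + 1), c (List.ofFn η) • phi d (List.ofFn η) oneSeries

theorem modCompHomogeneous_zero {m : ℕ} (c : Series m) (d : Fin m → Series m) :
    modCompHomogeneous c d 0 = constSeries (c []) := by
  funext ν
  simp [modCompHomogeneous, phi, oneSeries, constSeries]

theorem modCompHomogeneous_succ {m : ℕ} (c : Series m) (d : Fin m → Series m) (k : ℕ) :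
    modCompHomogeneous c d (k + 1) =
      ∑ i, phiLetterLinear d i (modCompHomogeneous (leftQuot i c) d k) := by
  simp only [modCompHomogeneous, map_sum, LinearMap.map_smul]
  rw [← (Fin.consEquiv fun _ : Fin (k + 1) => Fin (m + 1)).sum_comp, Fintype.sum_prod_type]
  simp [Fin.consEquiv, List.ofFn_succ, phi, leftQuot, phiLetterLinear_apply]

theorem modComp_eq_sum_of_length_lt {m : ℕ} (c : Series m) (d : Fin m → Series m) {ν : Word m}
    {n : ℕ} (h : ν.length < n) :
    modComp c d ν = (∑ k ∈ Finset.range n, modCompHomogeneous c d k) ν := by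
  simp only [modComp, modCompHomogeneous, Finset.sum_apply, Pi.smul_apply, smul_eq_mul]
  refine Finset.sum_subset (Finset.range_mono h) fun k _ hk => Finset.sum_eq_zero fun η _ => ?_
  rw [phi_apply_eq_zero, mul_zero]
  rw [Finset.mem_range] at hk
  rw [List.length_ofFn]
  omega

theorem modComp_apply_nil {m : ℕ} (c : Series m) (d : Fin m → Series m) :
    modComp c d [] = c [] := by
  simp [modComp, phi, oneSeries]

theorem modComp_apply_cons {m : ℕ} (c : Series m) (d : Fin m → Series m) (j : Fin (m + 1))
    (w : Word m) :
    modComp c d (j :: w) = ∑ i, phiLetter d i (modComp (leftQuot i c) d) (j :: w) := by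
  rw [modComp_eq_sum_of_length_lt c d (Nat.lt_succ_self _), List.length_cons,
    Finset.sum_range_succ', modCompHomogeneous_zero]
  simp only [modCompHomogeneous_succ]
  rw [Finset.sum_comm]
  simp only [← map_sum, Pi.add_apply, Finset.sum_apply, constSeries, reduceCtorEq, if_false,
    add_zero]
  refine Finset.sum_congr rfl fun i _ => ?_
  exact phiLetter_congr d i j fun u hu =>
    (modComp_eq_sum_of_length_lt _ d (Nat.lt_succ_of_le hu)).symm

/-- writing `c = (c,∅)∅ + Σ_{i=0}^m x_i c^i` with `c^i` the left
quotients of `c`, one has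
`c ∘̃ d = (c,∅)∅ + Σ_{j=1}^m x_j (c^j ∘̃ d) + x_0 (c^0 ∘̃ d + Σ_{j=1}^m d_j ⧢ (c^j ∘̃ d))`.
In particular `(c ∘̃ d, ∅) = (c, ∅)` and `(c ∘̃ d, x_j η) = (c^j ∘̃ d, η)` for
`j ∈ {1,…,m}`. -/
theorem modComp_decomposition (m : ℕ) (c : Series m) (d : SeriesVec m m) :
    (modComp c d =
        constSeries (c []) +
        (∑ j : Fin m, prepend j.succ (modComp (leftQuot j.succ c) d)) +
        prepend 0
          (modComp (leftQuot 0 c) d +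
            ∑ j : Fin m, shuffle (d j) (modComp (leftQuot j.succ c) d))) ∧
    modComp c d [] = c [] ∧
    (∀ (j : Fin m) (η : Word m), modComp c d (j.succ :: η) = modComp (leftQuot j.succ c) d η) := by
  have hsucc (j : Fin m) (η : Word m) :
      modComp c d (j.succ :: η) = modComp (leftQuot j.succ c) d η := by
    simp [modComp_apply_cons, phiLetter, prepend]
  refine ⟨?_, modComp_apply_nil c d, hsucc⟩
  funext ν
  cases ν with
  | nil => simp [modComp_apply_nil, constSeries, prepend]
  | cons j w =>
    cases j using Fin.cases with
    | zero =>
      simp [modComp_apply_cons, phiLetter, prepend, constSeries, Fin.sum_univ_succ, dhat,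
        shuffle_zero_left, (Fin.succ_ne_zero _).symm]
    | succ j => simp [hsucc, prepend, constSeries]
end

section
/- Let c ∈ ℝ^m⟨⟨X⟩⟩ satisfy |(c, η)| ≤ K_c M_c^{|η|} |η|! for all η ∈ X* with constants K_c, M_c > 0, and let c^{-1} be its composition inverse (the unique series with c^{-1} = (−c) ∘̃ c^{-1}). Then there exists K > 0 such that |(c^{-1}, η)| ≤ K (𝒜(K_c) M_c)^{|η|} |η|! for all η ∈ X*, where 𝒜(K_c) = 1 / (1 − m K_c ln(1 + 1/(m K_c))). Moreover, this geometric growth constant is sharp for the class of series with growth constants K_c, M_c: no constant smaller than 𝒜(K_c) M_c satisfies such a bound for every series in the class. In particular c^{-1} is locally convergent. -/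
open scoped BigOperators

/-- `𝒜(K_c) = 1 / (1 − m K_c ln(1 + 1/(m K_c)))`. -/
noncomputable def gainA (m : ℕ) (Kc : ℝ) : ℝ :=
  1 / (1 - m * Kc * Real.log (1 + 1 / (m * Kc)))

section Words

variable {m : ℕ}

theorem shuffle_congr {c c' d d' : Series m} {ν : Word m}
    (hc : ∀ w : Word m, w.length ≤ ν.length → c w = c' w)
    (hd : ∀ w : Word m, w.length ≤ ν.length → d w = d' w) :
    shuffle c d ν = shuffle c' d' ν := by
  induction ν generalizing c c' d d' with
  | nil => simp [shuffle, hc [] le_rfl, hd [] le_rfl]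
  | cons i η ih =>
    have hle : ∀ w : Word m, w.length ≤ η.length → w.length ≤ (i :: η).length :=
      fun w hw => hw.trans (Nat.le_succ _)
    have hcons : ∀ w : Word m, w.length ≤ η.length → (i :: w).length ≤ (i :: η).length :=
      fun w hw => Nat.succ_le_succ hw
    simp only [shuffle]
    rw [ih (fun w hw => hc _ (hcons w hw)) (fun w hw => hd _ (hle w hw)),
      ih (fun w hw => hc _ (hle w hw)) (fun w hw => hd _ (hcons w hw))]

theorem shuffle_sum_right {ι : Type*} (s : Finset ι) (c : Series m) (r : ι → ℝ)
    (e : ι → Series m) (ν : Word m) :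
    shuffle c (fun w => ∑ a ∈ s, r a * e a w) ν = ∑ a ∈ s, r a * shuffle c (e a) ν := by
  induction ν generalizing c e with
  | nil =>
    simp only [shuffle, Finset.mul_sum]
    exact Finset.sum_congr rfl fun a _ => by ring
  | cons i η ih =>
    simp only [shuffle]
    rw [ih (fun w => c (i :: w)) e, ih c (fun a w => e a (i :: w)), ← Finset.sum_add_distrib]
    exact Finset.sum_congr rfl fun a _ => by ring

theorem shuffle_zero_right (c : Series m) (ν : Word m) : shuffle c (fun _ => 0) ν = 0 := by
  simpa using shuffle_sum_right (∅ : Finset ℕ) c (fun _ => 0) (fun _ => c) ν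

theorem phi_eq_zero_of_length_lt (d : Fin m → Series m) {η w : Word m}
    (h : w.length < η.length) : phi d η oneSeries w = 0 := by
  induction η generalizing w with
  | nil => simp at h
  | cons ℓ η ih =>
    cases w with
    | nil => simp [phi, phiLetter, prepend]
    | cons j w =>
      have hw : w.length < η.length := by simpa using h
      have hs : shuffle (dhat d ℓ) (phi d η oneSeries) w = 0 := by
        rw [shuffle_congr (fun _ _ => rfl) (fun v hv => ih (hv.trans_lt hw)),
          shuffle_zero_right]
      simp [phi, phiLetter, prepend, ih hw, hs]

theorem modComp_eq_sum_range (c : Series m) (d : Fin m → Series m) {ν : Word m} {N : ℕ}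
    (h : ν.length ≤ N) :
    modComp c d ν = ∑ k ∈ Finset.range (N + 1), ∑ η : Fin k → Fin (m + 1),
      c (List.ofFn η) * phi d (List.ofFn η) oneSeries ν := by
  refine Finset.sum_subset (by simpa using h) fun k _ hk => Finset.sum_eq_zero fun η _ => ?_
  rw [phi_eq_zero_of_length_lt d (by simpa using hk), mul_zero]

theorem modComp_nil (c : Series m) (d : Fin m → Series m) : modComp c d [] = c [] := by
  simp [modComp, phi, oneSeries]

/-- The left quotients of a modified composition product. -/
theorem modComp_cons (c : Series m) (d : Fin m → Series m) (j : Fin (m + 1)) (ν : Word m) :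
    modComp c d (j :: ν) = modComp (leftQuot j c) d ν +
      if j = 0 then ∑ i : Fin m, shuffle (d i) (modComp (leftQuot i.succ c) d) ν else 0 := by
  have hshuffle : ∀ i : Fin m, shuffle (d i) (modComp (leftQuot i.succ c) d) ν =
      ∑ k ∈ Finset.range (ν.length + 1), ∑ η : Fin k → Fin (m + 1),
        c (i.succ :: List.ofFn η) * shuffle (d i) (phi d (List.ofFn η) oneSeries) ν := by
    intro i
    rw [shuffle_congr (fun _ _ => rfl) (fun w hw => modComp_eq_sum_range _ d hw)]
    simp only [Finset.sum_sigma', leftQuot]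
    exact shuffle_sum_right _ (d i)
      (fun a : (k : ℕ) × (Fin k → Fin (m + 1)) => c (i.succ :: List.ofFn a.2))
      (fun a => phi d (List.ofFn a.2) oneSeries) ν
  have hzero : ∀ e : Series m, shuffle (0 : Series m) e ν = 0 := by
    have : ∀ (μ : Word m) (e : Series m), shuffle (fun _ => 0) e μ = 0 := by
      intro μ
      induction μ with
      | nil => intro e; simp [shuffle]
      | cons i η ih => intro e; simp [shuffle, ih]
    exact this ν
  have hterm : ∀ (k : ℕ) (η : Fin k → Fin (m + 1)) (ℓ : Fin (m + 1)),
      c (ℓ :: List.ofFn η) * phi d (ℓ :: List.ofFn η) oneSeries (j :: ν) =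
        (if j = ℓ then c (j :: List.ofFn η) * phi d (List.ofFn η) oneSeries ν else 0) +
        if j = 0 then c (ℓ :: List.ofFn η) *
          shuffle (dhat d ℓ) (phi d (List.ofFn η) oneSeries) ν else 0 := by
    intro k η ℓ
    simp only [phi, phiLetter, prepend, Pi.add_apply, mul_add, mul_ite, mul_zero]
    by_cases hj : j = ℓ
    · subst hj; simp
    · simp [hj]
  rw [modComp, List.length_cons, Finset.sum_range_succ']
  have hsplit : ∀ k : ℕ, ∑ η : Fin (k + 1) → Fin (m + 1),
      c (List.ofFn η) * phi d (List.ofFn η) oneSeries (j :: ν) =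
      ∑ η : Fin k → Fin (m + 1), (c (j :: List.ofFn η) * phi d (List.ofFn η) oneSeries ν +
        if j = 0 then ∑ i : Fin m, c (i.succ :: List.ofFn η) *
          shuffle (d i) (phi d (List.ofFn η) oneSeries) ν else 0) := by
    intro k
    rw [← (Fin.consEquiv fun _ => Fin (m + 1)).sum_comp, Fintype.sum_prod_type_right]
    refine Finset.sum_congr rfl fun η _ => ?_
    simp only [Fin.consEquiv, Equiv.coe_fn_mk, List.ofFn_cons, hterm, Finset.sum_add_distrib]
    congr 1
    · simp
    · split_ifs
      · rw [Fin.sum_univ_succ]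
        simp [dhat, hzero]
      · simp
  simp only [hsplit, hshuffle]
  simp only [Finset.sum_add_distrib]
  rw [add_assoc]
  congr 1
  split_ifs
  · have hnil : ∑ η : Fin 0 → Fin (m + 1),
        c (List.ofFn η) * phi d (List.ofFn η) oneSeries (j :: ν) = 0 := by
      simp [phi, oneSeries]
    rw [hnil, add_zero]
    symm
    rw [Finset.sum_comm]
    exact Finset.sum_congr rfl fun k _ => Finset.sum_comm
  · simp [phi, oneSeries]

theorem modComp_congr {c : Series m} {d d' : Fin m → Series m} {ν : Word m}
    (h : ∀ (w : Word m) (i : Fin m), w.length < ν.length → d i w = d' i w) :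
    modComp c d ν = modComp c d' ν := by
  induction hn : ν.length using Nat.strong_induction_on generalizing c ν with
  | _ n ih =>
    cases ν with
    | nil => simp [modComp_nil]
    | cons j ν =>
      have hlt : ∀ w : Word m, w.length ≤ ν.length → w.length < (j :: ν).length :=
        fun w hw => Nat.lt_succ_of_le hw
      have hrec : ∀ (c : Series m) (w : Word m), w.length ≤ ν.length →
          modComp c d w = modComp c d' w := fun c w hw =>
        ih _ (hn ▸ hlt w hw) (fun v i hv => h v i (hv.trans (hlt w hw))) rfl
      rw [modComp_cons, modComp_cons, hrec _ ν le_rfl]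
      simp only [shuffle_congr (fun w hw => h w _ (hlt w hw)) (fun w hw => hrec _ w hw)]

theorem exists_eq_modCompVec (c : SeriesVec m m) : ∃ d : SeriesVec m m, d = modCompVec c d := by
  let D : ℕ → SeriesVec m m := fun N => (modCompVec c)^[N] 0
  have hD : ∀ N, D (N + 1) = modCompVec c (D N) := fun N => Function.iterate_succ_apply' _ _ _
  have hstab : ∀ (n N : ℕ) (ν : Word m) (i : Fin m), ν.length < n → n ≤ N →
      D N i ν = D n i ν := by
    intro n
    induction n with
    | zero => intro N ν i h; omega
    | succ n ih =>
      intro N ν i hν hN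
      obtain ⟨N, rfl⟩ : ∃ N', N = N' + 1 := ⟨N - 1, by omega⟩
      rw [hD, hD]
      exact modComp_congr fun w i hw => ih N w i (by omega) (by omega)
  refine ⟨fun i ν => D (ν.length + 1) i ν, ?_⟩
  funext i ν
  rw [hD]
  exact modComp_congr fun w i hw => hstab _ _ w i (Nat.lt_succ_self _) hw

open PowerSeries

theorem factorial_succ_mul_coeff_succ (f : ℝ⟦X⟧) (n : ℕ) :
    ((n + 1).factorial : ℝ) * coeff (n + 1) f = n.factorial * coeff n (d⁄dX ℝ f) := by
  rw [coeff_derivative, Nat.factorial_succ]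
  push_cast
  ring

theorem factorial_succ_mul_coeff_succ_mul (f g : ℝ⟦X⟧) (n : ℕ) :
    ((n + 1).factorial : ℝ) * coeff (n + 1) (f * g) =
      n.factorial * coeff n (d⁄dX ℝ f * g) + n.factorial * coeff n (f * d⁄dX ℝ g) := by
  rw [factorial_succ_mul_coeff_succ, Derivation.leibniz, map_add, smul_eq_mul, smul_eq_mul,
    mul_comm g, mul_add, add_comm]

theorem abs_shuffle_le {c d : Series m} {f g : ℝ⟦X⟧} {ν : Word m}
    (hc : ∀ w : Word m, w.length ≤ ν.length → |c w| ≤ w.length.factorial * coeff w.length f)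
    (hd : ∀ w : Word m, w.length ≤ ν.length → |d w| ≤ w.length.factorial * coeff w.length g) :
    |shuffle c d ν| ≤ ν.length.factorial * coeff ν.length (f * g) := by
  induction ν generalizing c d f g with
  | nil =>
    have hc' := hc [] le_rfl
    have hd' := hd [] le_rfl
    simp only [List.length_nil, Nat.factorial_zero, Nat.cast_one, one_mul, shuffle, abs_mul,
      coeff_zero_eq_constantCoeff, map_mul] at *
    exact mul_le_mul hc' hd' (abs_nonneg _) ((abs_nonneg _).trans hc')
  | cons i η ih =>
    have hle : ∀ w : Word m, w.length ≤ η.length → w.length ≤ (i :: η).length :=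
      fun w hw => hw.trans (Nat.le_succ _)
    have hcons : ∀ w : Word m, w.length ≤ η.length → (i :: w).length ≤ (i :: η).length :=
      fun w hw => Nat.succ_le_succ hw
    simp only [shuffle, List.length_cons]
    rw [factorial_succ_mul_coeff_succ_mul]
    refine (abs_add_le _ _).trans (add_le_add (ih ?_ ?_) (ih ?_ ?_))
    · intro w hw
      simpa [factorial_succ_mul_coeff_succ] using hc _ (hcons w hw)
    · exact fun w hw => hd w (hle w hw)
    · exact fun w hw => hc w (hle w hw)
    · intro w hw
      simpa [factorial_succ_mul_coeff_succ] using hd _ (hcons w hw)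

theorem shuffle_replicate {c d : Series m} {f g : ℝ⟦X⟧} {n : ℕ} (i : Fin (m + 1))
    (hc : ∀ k ≤ n, c (List.replicate k i) = k.factorial * coeff k f)
    (hd : ∀ k ≤ n, d (List.replicate k i) = k.factorial * coeff k g) :
    shuffle c d (List.replicate n i) = n.factorial * coeff n (f * g) := by
  induction n generalizing c d f g with
  | zero =>
    have hc' := hc 0 le_rfl
    have hd' := hd 0 le_rfl
    simp only [List.replicate_zero, Nat.factorial_zero, Nat.cast_one, one_mul, shuffle,
      coeff_zero_eq_constantCoeff, map_mul] at *
    rw [hc', hd']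
  | succ n ih =>
    rw [factorial_succ_mul_coeff_succ_mul, List.replicate_succ, shuffle]
    congr 1
    · refine ih (fun k hk => ?_) (fun k hk => hd k (hk.trans n.le_succ))
      rw [← factorial_succ_mul_coeff_succ]
      exact hc (k + 1) (Nat.succ_le_succ hk)
    · refine ih (fun k hk => hc k (hk.trans n.le_succ)) (fun k hk => ?_)
      rw [← factorial_succ_mul_coeff_succ]
      exact hd (k + 1) (Nat.succ_le_succ hk)

/-- Majorization of a fixed point `d` by exponential generating functions `A k`, which bound the
compositions with `d` of all `k`-fold left quotients. -/
theorem abs_modComp_le {K M : ℝ} {A : ℕ → ℝ⟦X⟧}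
    (hA₀ : ∀ k, constantCoeff (A k) = K * M ^ k * k.factorial)
    (hA : ∀ k, d⁄dX ℝ (A k) = A (k + 1) + C (m : ℝ) * (A 0 * A (k + 1)))
    {c d : SeriesVec m m}
    (hc : ∀ (η : Word m) (i : Fin m), |c i η| ≤ K * M ^ η.length * η.length.factorial)
    (hd : d = modCompVec c d) (k : ℕ) (e : Series m)
    (he : ∀ η : Word m, |e η| ≤ K * M ^ (η.length + k) * (η.length + k).factorial)
    (ν : Word m) :
    |modComp e d ν| ≤ ν.length.factorial * coeff ν.length (A k) := by
  induction hn : ν.length using Nat.strong_induction_on generalizing k e ν with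
  | _ n ih =>
    subst hn
    cases ν with
    | nil => simpa [modComp_nil, hA₀] using he []
    | cons j ν =>
      have hlt : ∀ w : Word m, w.length ≤ ν.length → w.length < (j :: ν).length :=
        fun w hw => Nat.lt_succ_of_le hw
      have hq : ∀ (ℓ : Fin (m + 1)) (η : Word m), |leftQuot ℓ e η| ≤
          K * M ^ (η.length + (k + 1)) * (η.length + (k + 1)).factorial := by
        intro ℓ η
        have := he (ℓ :: η)
        rwa [List.length_cons, show η.length + 1 + k = η.length + (k + 1) by ring] at this
      have hdw : ∀ (i : Fin m) (w : Word m), w.length ≤ ν.length →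
          |d i w| ≤ w.length.factorial * coeff w.length (A 0) := by
        intro i w hw
        rw [hd]
        exact ih _ (hlt w hw) 0 (c i) (fun η => hc η i) w rfl
      have hsh : ∀ i : Fin m, |shuffle (d i) (modComp (leftQuot i.succ e) d) ν| ≤
          ν.length.factorial * coeff ν.length (A 0 * A (k + 1)) := fun i =>
        abs_shuffle_le (hdw i) fun w hw => ih _ (hlt w hw) (k + 1) _ (hq i.succ) w rfl
      have hpos : 0 ≤ m * (ν.length.factorial * coeff ν.length (A 0 * A (k + 1))) := by
        rcases Nat.eq_zero_or_pos m with h0 | h0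
        · simp [h0]
        · exact mul_nonneg (Nat.cast_nonneg _) ((abs_nonneg _).trans (hsh ⟨0, h0⟩))
      rw [List.length_cons, factorial_succ_mul_coeff_succ, hA, map_add, coeff_C_mul, mul_add,
        modComp_cons, mul_left_comm]
      refine (abs_add_le _ _).trans
        (add_le_add (ih _ (hlt ν le_rfl) (k + 1) _ (hq j) ν rfl) ?_)
      split_ifs
      · refine (Finset.abs_sum_le_sum_abs _ _).trans ((Finset.sum_le_sum fun i _ => hsh i).trans ?_)
        simp
      · simpa using hpos

/-- For the extremal series, the bound of `abs_modComp_le` is attained on the words `x_0^n`. -/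
theorem modComp_replicate_zero {K M : ℝ} {A : ℕ → ℝ⟦X⟧}
    (hA₀ : ∀ k, constantCoeff (A k) = K * M ^ k * k.factorial)
    (hA : ∀ k, d⁄dX ℝ (A k) = A (k + 1) + C (m : ℝ) * (A 0 * A (k + 1)))
    {d : SeriesVec m m}
    (hd : d = modCompVec (fun _ η => K * M ^ η.length * η.length.factorial) d) (k n : ℕ) :
    modComp (fun η => K * M ^ (η.length + k) * (η.length + k).factorial) d (List.replicate n 0) =
      n.factorial * coeff n (A k) := by
  induction n using Nat.strong_induction_on generalizing k with
  | _ n ih =>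
    cases n with
    | zero => simp [modComp_nil, hA₀]
    | succ n =>
      have hq : ∀ ℓ : Fin (m + 1),
          leftQuot ℓ (fun η : Word m => K * M ^ (η.length + k) * (η.length + k).factorial) =
            fun η => K * M ^ (η.length + (k + 1)) * (η.length + (k + 1)).factorial := by
        intro ℓ
        funext η
        simp only [leftQuot, List.length_cons, show η.length + 1 + k = η.length + (k + 1) by ring]
      have hsh : ∀ i : Fin m, shuffle (d i) (modComp
          (fun η => K * M ^ (η.length + (k + 1)) * (η.length + (k + 1)).factorial) d)
          (List.replicate n 0) = n.factorial * coeff n (A 0 * A (k + 1)) := by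
        intro i
        refine shuffle_replicate 0 (fun l hl => ?_)
          (fun l hl => ih l (Nat.lt_succ_of_le hl) (k + 1))
        rw [hd]
        exact ih l (Nat.lt_succ_of_le hl) 0
      rw [factorial_succ_mul_coeff_succ, hA, map_add, coeff_C_mul, mul_add, mul_left_comm,
        List.replicate_succ, modComp_cons]
      simp only [hq, hsh, ih n n.lt_succ_self (k + 1), if_true]
      simp

end Words

section Formal

open PowerSeries

/-- If `P = X / h` and `H` is the derivative of `h`, where `h` has a simple zero, this is the
composition of `F` with the compositional inverse of `h`, by Lagrange inversion. -/
noncomputable def lagrange (P H F : ℝ⟦X⟧) : ℝ⟦X⟧ :=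
  PowerSeries.mk fun n => coeff n (F * P ^ (n + 1) * H)

theorem lagrange_add (P H F G : ℝ⟦X⟧) :
    lagrange P H (F + G) = lagrange P H F + lagrange P H G := by
  ext n
  simp [lagrange, add_mul]

theorem lagrange_C_mul (P H F : ℝ⟦X⟧) (a : ℝ) :
    lagrange P H (C a * F) = C a * lagrange P H F := by
  ext n
  simp [lagrange, mul_assoc]

theorem constantCoeff_lagrange {P H : ℝ⟦X⟧} (h₀ : constantCoeff P * constantCoeff H = 1)
    (F : ℝ⟦X⟧) : constantCoeff (lagrange P H F) = constantCoeff F := by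
  rw [← coeff_zero_eq_constantCoeff_apply]
  simp [lagrange, mul_assoc, h₀]

theorem derivative_lagrange {P H Φ : ℝ⟦X⟧} (hP : X * d⁄dX ℝ P = P - H * P ^ 2) (hΦ : Φ * H = 1)
    (F : ℝ⟦X⟧) : d⁄dX ℝ (lagrange P H F) = lagrange P H (Φ * d⁄dX ℝ F) := by
  ext n
  have hres : X * d⁄dX ℝ (F * P ^ (n + 1)) - C ((n : ℝ) + 1) * (F * P ^ (n + 1)) =
      X * (d⁄dX ℝ F * P ^ (n + 1)) - C ((n : ℝ) + 1) * (F * P ^ (n + 2) * H) := by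
    rw [Derivation.leibniz, derivative_pow]
    simp only [smul_eq_mul, Nat.add_sub_cancel, map_add, map_natCast, map_one, Nat.cast_add,
      Nat.cast_one]
    linear_combination ((n : ℝ⟦X⟧) + 1) * F * P ^ n * hP
  have hcoeff := congrArg (coeff (n + 1)) hres
  simp only [map_sub, coeff_succ_X_mul, coeff_C_mul, coeff_derivative (F * P ^ (n + 1))] at hcoeff
  rw [coeff_derivative, lagrange, lagrange, coeff_mk, coeff_mk,
    show Φ * d⁄dX ℝ F * P ^ (n + 1) * H = d⁄dX ℝ F * P ^ (n + 1) by
      linear_combination d⁄dX ℝ F * P ^ (n + 1) * hΦ]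
  linear_combination hcoeff

theorem lagrange_one {P H Φ : ℝ⟦X⟧} (h₀ : constantCoeff P * constantCoeff H = 1)
    (hP : X * d⁄dX ℝ P = P - H * P ^ 2) (hΦ : Φ * H = 1) : lagrange P H 1 = 1 := by
  refine derivative.ext ?_ (constantCoeff_lagrange h₀ 1)
  rw [derivative_lagrange hP hΦ, derivative_one]
  ext n
  simp [lagrange]

theorem lagrange_mul {P H Φ : ℝ⟦X⟧} (h₀ : constantCoeff P * constantCoeff H = 1)
    (hP : X * d⁄dX ℝ P = P - H * P ^ 2) (hΦ : Φ * H = 1) (F G : ℝ⟦X⟧) :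
    lagrange P H (F * G) = lagrange P H F * lagrange P H G := by
  ext n
  induction n generalizing F G with
  | zero => simp [constantCoeff_lagrange h₀]
  | succ n ih =>
    have h : coeff n (d⁄dX ℝ (lagrange P H (F * G))) =
        coeff n (d⁄dX ℝ (lagrange P H F * lagrange P H G)) := by
      rw [derivative_lagrange hP hΦ, Derivation.leibniz, Derivation.leibniz,
        derivative_lagrange hP hΦ, derivative_lagrange hP hΦ]
      simp only [smul_eq_mul]
      rw [show Φ * (F * d⁄dX ℝ G + G * d⁄dX ℝ F) = F * (Φ * d⁄dX ℝ G) + G * (Φ * d⁄dX ℝ F) by ring,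
        lagrange_add, map_add, map_add, ih, ih]
    rw [coeff_derivative, coeff_derivative] at h
    exact mul_right_cancel₀ (by positivity) h

/-- A series with nonnegative coefficients whose sum is at most `S`. -/
def NonnegSumLE (f : ℝ⟦X⟧) (S : ℝ) : Prop :=
  (∀ n, 0 ≤ coeff n f) ∧ ∀ N, ∑ n ∈ Finset.range N, coeff n f ≤ S

theorem sum_range_coeff_mul_le {f g : ℝ⟦X⟧} (hf : ∀ n, 0 ≤ coeff n f) (hg : ∀ n, 0 ≤ coeff n g)
    (N : ℕ) : ∑ n ∈ Finset.range N, coeff n (f * g) ≤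
      (∑ n ∈ Finset.range N, coeff n f) * ∑ n ∈ Finset.range N, coeff n g := by
  simp only [coeff_mul, Finset.Nat.sum_antidiagonal_eq_sum_range_succ_mk, Finset.sum_mul_sum]
  rw [Finset.sum_range_diag_flip N fun i j => coeff i f * coeff j g]
  exact Finset.sum_le_sum fun i _ => Finset.sum_le_sum_of_subset_of_nonneg
    (Finset.range_mono (Nat.sub_le _ _)) fun j _ _ => mul_nonneg (hf i) (hg j)

theorem NonnegSumLE.mul {f g : ℝ⟦X⟧} {S T : ℝ} (hf : NonnegSumLE f S) (hg : NonnegSumLE g T) :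
    NonnegSumLE (f * g) (S * T) := by
  refine ⟨fun n => ?_, fun N => ?_⟩
  · rw [coeff_mul]
    exact Finset.sum_nonneg fun p _ => mul_nonneg (hf.1 _) (hg.1 _)
  · exact (sum_range_coeff_mul_le hf.1 hg.1 N).trans (mul_le_mul (hf.2 N) (hg.2 N)
      (Finset.sum_nonneg fun n _ => hg.1 n) (by simpa using hf.2 0))

theorem NonnegSumLE.pow {f : ℝ⟦X⟧} {S : ℝ} (hf : NonnegSumLE f S) (k : ℕ) :
    NonnegSumLE (f ^ k) (S ^ k) := by
  induction k with
  | zero =>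
    refine ⟨fun n => ?_, fun N => ?_⟩
    · rw [pow_zero, coeff_one]
      split_ifs <;> norm_num
    · simp only [pow_zero, coeff_one, Finset.sum_ite_eq']
      split_ifs <;> norm_num
  | succ k ih => simpa only [pow_succ] using ih.mul hf

theorem NonnegSumLE.coeff_le {f : ℝ⟦X⟧} {S : ℝ} (hf : NonnegSumLE f S) (n : ℕ) :
    coeff n f ≤ S := by
  refine le_trans ?_ (hf.2 (n + 1))
  exact Finset.single_le_sum (f := fun n => coeff n f) (fun i _ => hf.1 i)
    (Finset.self_mem_range_succ n)

theorem NonnegSumLE.of_mul_one_sub_eq_one {P G : ℝ⟦X⟧} {S : ℝ} (hG : NonnegSumLE G S)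
    (hS : S < 1) (hP : P * (1 - G) = 1) : NonnegSumLE P (1 / (1 - S)) := by
  have hrec : P = 1 + G * P := by linear_combination hP
  have hG₀ : constantCoeff G < 1 := by
    simpa using (hG.coeff_le 0).trans_lt hS
  have hnonneg : ∀ n, 0 ≤ coeff n P := by
    intro n
    induction n using Nat.strong_induction_on with
    | _ n ih =>
      have h := congrArg (coeff n) hrec
      rw [map_add, coeff_mul, ← Finset.Nat.sum_antidiagonal_swap,
        Finset.Nat.sum_antidiagonal_eq_sum_range_succ_mk, Finset.sum_range_succ] at h
      simp only [Prod.fst_swap, Prod.snd_swap, Nat.sub_self, coeff_zero_eq_constantCoeff] at h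
      have h₁ : 0 ≤ coeff n (1 : ℝ⟦X⟧) := by
        rw [coeff_one]
        split_ifs <;> norm_num
      have h₂ : 0 ≤ ∑ k ∈ Finset.range n, coeff (n - k) G * coeff k P :=
        Finset.sum_nonneg fun k hk => mul_nonneg (hG.1 _) (ih k (Finset.mem_range.1 hk))
      have h₃ : 0 ≤ (1 - constantCoeff G) * coeff n P := by linarith
      exact nonneg_of_mul_nonneg_right h₃ (by linarith)
  refine ⟨hnonneg, fun N => ?_⟩
  have h₁ : ∑ n ∈ Finset.range N, coeff n P ≤
      1 + S * ∑ n ∈ Finset.range N, coeff n P := by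
    conv_lhs => rw [hrec]
    simp only [map_add, Finset.sum_add_distrib]
    refine add_le_add ?_ ((sum_range_coeff_mul_le hG.1 hnonneg N).trans
      (mul_le_mul_of_nonneg_right (hG.2 N) (Finset.sum_nonneg fun n _ => hnonneg n)))
    simp only [coeff_one, Finset.sum_ite_eq']
    split_ifs <;> norm_num
  rw [le_div_iff₀ (by linarith)]
  linarith

theorem mul_log_one_add_inv_lt_one {x : ℝ} (hx : 0 < x) : x * Real.log (1 + 1 / x) < 1 := by
  have h := Real.log_lt_sub_one_of_pos (x := 1 + 1 / x) (by positivity)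
    (by simpa using hx.ne')
  calc x * Real.log (1 + 1 / x) < x * (1 + 1 / x - 1) := mul_lt_mul_of_pos_left h hx
    _ = 1 := by field_simp; ring

theorem nonnegSumLE_log_series {x : ℝ} (hx : 0 < x) :
    NonnegSumLE (PowerSeries.mk fun n : ℕ => x * ((1 + x)⁻¹ ^ (n + 1) / (n + 1)))
      (x * Real.log (1 + 1 / x)) := by
  have hlt : |(1 + x)⁻¹| < 1 := by
    rw [abs_of_pos (by positivity)]
    exact inv_lt_one_of_one_lt₀ (by linarith)
  have hsum := (Real.hasSum_pow_div_log_of_abs_lt_one hlt).mul_left x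
  have hinv : (1 - (1 + x)⁻¹)⁻¹ = 1 + 1 / x := by
    rw [show 1 - (1 + x)⁻¹ = x / (1 + x) by field_simp; ring, inv_div, add_div,
      div_self hx.ne', add_comm]
  rw [← Real.log_inv, hinv] at hsum
  refine ⟨fun n => ?_, fun N => ?_⟩
  · rw [coeff_mk]
    positivity
  · simp only [coeff_mk]
    exact sum_le_hasSum _ (fun n _ => by positivity) hsum

/-- The solution `B` of `dB/dt = K⁻¹ B² (1 + m B)`, `B(0) = K`, together with the series
`T = ∫ (1 + m B)`, and the growth of the coefficients of `B`. -/
theorem exists_extremal_series {m : ℕ} (hm : 0 < m) {K : ℝ} (hK : 0 < K) :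
    ∃ B T : ℝ⟦X⟧, constantCoeff B = K ∧
      d⁄dX ℝ B = C K⁻¹ * B ^ 2 * (1 + C (m : ℝ) * B) ∧
      constantCoeff T = 0 ∧ d⁄dX ℝ T = 1 + C (m : ℝ) * B ∧ B * (1 - T) = C K ∧
      ∀ n, m * coeff n B ≤ gainA m K ^ (n + 1) := by
  have hm' : (0 : ℝ) < m := Nat.cast_pos.2 hm
  obtain ⟨x, hxdef⟩ : ∃ x : ℝ, x = m * K := ⟨_, rfl⟩
  have hx : 0 < x := hxdef ▸ mul_pos hm' hK
  have hx1 : (1 : ℝ) + x ≠ 0 := by positivity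
  set U : ℝ⟦X⟧ := PowerSeries.mk fun _ => 1 with hU
  set V : ℝ⟦X⟧ := PowerSeries.mk fun n => (1 + x)⁻¹ ^ (n + 1) with hV
  set G : ℝ⟦X⟧ := PowerSeries.mk fun n : ℕ => x * ((1 + x)⁻¹ ^ (n + 1) / (n + 1)) with hG
  have hU1 : U * (1 - X) = 1 := mk_one_mul_one_sub_eq_one ℝ
  have hV1 : V * (C (1 + x) - X) = 1 := by
    ext n
    cases n with
    | zero => simp [hV, hx1]
    | succ n =>
      rw [mul_sub, map_sub, mul_comm V, coeff_C_mul, coeff_succ_mul_X, hV, coeff_mk, coeff_mk,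
        coeff_one, if_neg n.succ_ne_zero, pow_succ _ (n + 1)]
      field_simp
      ring
  have hUV : U - V = C x * (U * V) := by
    have : (C (1 + x) : ℝ⟦X⟧) = 1 + C x := by simp
    rw [this] at hV1
    linear_combination V * hU1 - U * hV1
  have hΦ : (1 + C x * U) * (1 - C x * V) = 1 := by linear_combination C x * hUV
  have hH : (1 - C x * V) = (1 - G) + X * d⁄dX ℝ (1 - G) := by
    have : C x * V = G + X * d⁄dX ℝ G := by
      ext n
      cases n with
      | zero => simp [hV, hG]
      | succ n =>
        rw [map_add, coeff_succ_X_mul, coeff_derivative, coeff_C_mul, hV, hG, coeff_mk, coeff_mk]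
        push_cast
        field_simp
        ring
    rw [this, map_sub, derivative_one]
    ring
  have hGS : NonnegSumLE G (x * Real.log (1 + 1 / x)) := nonnegSumLE_log_series hx
  have hS := mul_log_one_add_inv_lt_one hx
  have hG0 : constantCoeff (1 - G) ≠ 0 := by
    have : constantCoeff G < 1 := by simpa using (hGS.coeff_le 0).trans_lt hS
    rw [map_sub, map_one]
    linarith
  obtain ⟨P, hPG⟩ : ∃ P : ℝ⟦X⟧, P * (1 - G) = 1 :=
    ⟨(1 - G)⁻¹, PowerSeries.inv_mul_cancel _ hG0⟩
  set H : ℝ⟦X⟧ := 1 - C x * V with hHdef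
  have h₀ : constantCoeff P * constantCoeff H = 1 := by
    rw [hH, ← map_mul, mul_add, hPG]
    simp
  have hP : X * d⁄dX ℝ P = P - H * P ^ 2 := by
    have h := congrArg (d⁄dX ℝ) hPG
    rw [Derivation.leibniz, derivative_one, smul_eq_mul, smul_eq_mul] at h
    rw [hH]
    linear_combination X * P * h - (X * d⁄dX ℝ P - P) * hPG
  have hgain : gainA m K = 1 / (1 - x * Real.log (1 + 1 / x)) := by rw [gainA, hxdef]
  have hPS : NonnegSumLE P (gainA m K) := hgain ▸ hGS.of_mul_one_sub_eq_one hS hPG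
  have hCx : (C x : ℝ⟦X⟧) = C (m : ℝ) * C K := by rw [hxdef, map_mul]
  have hdU : d⁄dX ℝ U = U ^ 2 := by
    have h := congrArg (d⁄dX ℝ) hU1
    rw [Derivation.leibniz, derivative_one, smul_eq_mul, smul_eq_mul, map_sub, derivative_one,
      derivative_X] at h
    linear_combination U * h - d⁄dX ℝ U * hU1
  have hKK : (C K⁻¹ : ℝ⟦X⟧) * C K = 1 := by
    rw [← map_mul, inv_mul_cancel₀ hK.ne', map_one]
  have hone := lagrange_one h₀ hP hΦ
  refine ⟨lagrange P H (C K * U), lagrange P H X, ?_, ?_, ?_, ?_, ?_, ?_⟩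
  · rw [constantCoeff_lagrange h₀]
    simp [hU]
  · rw [derivative_lagrange hP hΦ, Derivation.leibniz, derivative_C, hdU]
    simp only [smul_eq_mul, mul_zero, add_zero]
    rw [show (1 + C x * U) * (C K * U ^ 2) =
        (C K⁻¹ * ((C K * U) * (C K * U))) * (1 + C (m : ℝ) * (C K * U)) by
      rw [hCx]; linear_combination (-(C K * U ^ 2) * (1 + C (m : ℝ) * (C K * U))) * hKK,
      lagrange_mul h₀ hP hΦ, lagrange_C_mul, lagrange_mul h₀ hP hΦ, lagrange_add,
      lagrange_C_mul P H (C K * U) m, hone]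
    ring
  · rw [constantCoeff_lagrange h₀, constantCoeff_X]
  · rw [derivative_lagrange hP hΦ, derivative_X, mul_one, hCx, lagrange_add, hone, mul_assoc,
      lagrange_C_mul P H (C K * U) m]
  · have h : 1 - lagrange P H X = lagrange P H (1 - X) := by
      have := lagrange_add P H (1 - X) X
      rw [sub_add_cancel, hone] at this
      linear_combination this
    rw [h, ← lagrange_mul h₀ hP hΦ, mul_assoc, hU1, lagrange_C_mul, hone, mul_one]
  · intro n
    rw [← coeff_C_mul, ← lagrange_C_mul, ← mul_assoc, ← hCx]
    have h : lagrange P H (C x * U) + lagrange P H 1 =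
        PowerSeries.mk fun n => coeff n (P ^ (n + 1)) := by
      rw [← lagrange_add]
      ext n
      rw [lagrange, coeff_mk, coeff_mk,
        show (C x * U + 1) * P ^ (n + 1) * H = P ^ (n + 1) by
          linear_combination P ^ (n + 1) * hΦ]
    have hn := congrArg (coeff n) h
    rw [hone, map_add, coeff_mk] at hn
    have h₁ : 0 ≤ coeff n (1 : ℝ⟦X⟧) := by
      rw [coeff_one]
      split_ifs <;> norm_num
    linarith [(hPS.pow (n + 1)).coeff_le n]

end Formal

section Analytic

open PowerSeries

theorem summable_norm_coeff_mul_pow {f : ℝ⟦X⟧} {D ρ t : ℝ} (hρ : 0 < ρ)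
    (hf : ∀ n, |coeff n f| ≤ D * ρ ^ n) (ht : |t| < ρ⁻¹) :
    Summable fun n => ‖coeff n f * t ^ n‖ := by
  have hlt : ρ * |t| < 1 := by
    calc ρ * |t| < ρ * ρ⁻¹ := mul_lt_mul_of_pos_left ht hρ
      _ = 1 := mul_inv_cancel₀ hρ.ne'
  refine Summable.of_nonneg_of_le (fun n => norm_nonneg _) (fun n => ?_)
    ((summable_geometric_of_lt_one (by positivity) hlt).mul_left D)
  rw [norm_mul, norm_pow, Real.norm_eq_abs, Real.norm_eq_abs, mul_pow, ← mul_assoc]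
  exact mul_le_mul_of_nonneg_right (hf n) (by positivity)

theorem hasDerivAt_tsum_coeff_mul_pow {f : ℝ⟦X⟧} {D ρ t : ℝ} (hρ : 0 < ρ)
    (hf : ∀ n, |coeff n (d⁄dX ℝ f)| ≤ D * ρ ^ n) (ht : |t| < ρ⁻¹) :
    HasDerivAt (fun z => ∑' n, coeff n f * z ^ n) (∑' n, coeff n (d⁄dX ℝ f) * t ^ n) t := by
  obtain ⟨r, htr, hr⟩ := exists_between ht
  have hr0 : 0 < r := (abs_nonneg t).trans_lt htr
  have hsucc : ∀ (z : ℝ) (n : ℕ), coeff (n + 1) f * (((n + 1 : ℕ) : ℝ) * z ^ (n + 1 - 1)) =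
      coeff n (d⁄dX ℝ f) * z ^ n := by
    intro z n
    rw [coeff_derivative, Nat.add_sub_cancel]
    push_cast
    ring
  have hsum : ∀ z : ℝ, |z| < ρ⁻¹ → Summable fun n : ℕ => ‖coeff n f * (n * z ^ (n - 1))‖ := by
    intro z hz
    rw [← summable_nat_add_iff 1]
    simp only [hsucc]
    exact summable_norm_coeff_mul_pow hρ hf hz
  have h := hasDerivAt_tsum_of_isPreconnected (t := Metric.ball (0 : ℝ) r) (y := t) (y₀ := 0)
    (g := fun n z => coeff n f * z ^ n) (g' := fun n z => coeff n f * (n * z ^ (n - 1)))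
    (hsum r (by rwa [abs_of_pos hr0])) Metric.isOpen_ball
    (convex_ball (0 : ℝ) r).isPreconnected
    (fun n y _ => (hasDerivAt_pow n y).const_mul _)
    (fun n y hy => by
      have hy' : |y| ≤ |r| := by
        rw [abs_of_pos hr0]
        simpa using (mem_ball_zero_iff.1 hy).le
      simp only [norm_mul, norm_pow, Real.norm_eq_abs]
      gcongr)
    (Metric.mem_ball_self hr0)
    (summable_of_ne_finset_zero (s := {0}) fun n hn => by
      simp [show n ≠ 0 by simpa using hn])
    (mem_ball_zero_iff.2 (by simpa using htr))
  rw [(hsum t ht).of_norm.tsum_eq_zero_add] at h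
  simp only [hsucc] at h
  simpa using h

theorem tsum_coeff_mul_mul_pow {f g : ℝ⟦X⟧} {t : ℝ} (hf : Summable fun n => ‖coeff n f * t ^ n‖)
    (hg : Summable fun n => ‖coeff n g * t ^ n‖) :
    ∑' n, coeff n (f * g) * t ^ n = (∑' n, coeff n f * t ^ n) * ∑' n, coeff n g * t ^ n := by
  rw [tsum_mul_tsum_eq_tsum_sum_antidiagonal_of_summable_norm hf hg]
  refine tsum_congr fun n => ?_
  rw [coeff_mul, Finset.sum_mul]
  refine Finset.sum_congr rfl fun p hp => ?_
  rw [← Finset.HasAntidiagonal.mem_antidiagonal.1 hp, pow_add]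
  ring

theorem gainA_pos {m : ℕ} (hm : 0 < m) {K : ℝ} (hK : 0 < K) : 0 < gainA m K := by
  have := mul_log_one_add_inv_lt_one (mul_pos (Nat.cast_pos.2 hm : (0 : ℝ) < m) hK)
  exact one_div_pos.2 (by linarith)

/-- The coefficients of the extremal series cannot grow at a geometric rate below `gainA m K`:
otherwise the implicit solution of the differential equation would continue past its blow-up. -/
theorem gainA_le_of_abs_coeff_le {m : ℕ} (hm : 0 < m) {K : ℝ} (hK : 0 < K) {B T : ℝ⟦X⟧}
    (hT₀ : constantCoeff T = 0) (hT : d⁄dX ℝ T = 1 + C (m : ℝ) * B) (hBT : B * (1 - T) = C K)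
    {D ρ : ℝ} (hρ : 0 < ρ) (hB : ∀ n, |coeff n B| ≤ D * ρ ^ n) : gainA m K ≤ ρ := by
  by_contra! hlt
  have hm' : (0 : ℝ) < m := Nat.cast_pos.2 hm
  obtain ⟨x, hxdef⟩ : ∃ x : ℝ, x = m * K := ⟨_, rfl⟩
  have hx : 0 < x := hxdef ▸ mul_pos hm' hK
  have hA := gainA_pos hm hK
  have hone : ∀ n, |coeff n (1 : ℝ⟦X⟧)| ≤ 1 * ρ ^ n := by
    intro n
    rw [coeff_one]
    split_ifs with h
    · simp [h]
    · simpa using (pow_pos hρ n).le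
  have hdT : ∀ n, |coeff n (d⁄dX ℝ T)| ≤ (1 + m * D) * ρ ^ n := by
    intro n
    rw [hT, map_add, coeff_C_mul]
    refine (abs_add_le _ _).trans ?_
    rw [abs_mul, Nat.abs_cast]
    nlinarith [hone n, mul_le_mul_of_nonneg_left (hB n) hm'.le]
  have hTn : ∀ n, |coeff n T| ≤ (1 + m * D) / ρ * ρ ^ n := by
    intro n
    cases n with
    | zero =>
      have := (abs_nonneg _).trans (hdT 0)
      simp only [pow_zero, mul_one] at this
      simpa [hT₀] using div_nonneg this hρ.le
    | succ n =>
      have h := hdT n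
      rw [coeff_derivative, abs_mul] at h
      have h1 : (1 : ℝ) ≤ |(n : ℝ) + 1| := by
        rw [abs_of_pos (by positivity)]
        linarith [(Nat.cast_nonneg n : (0 : ℝ) ≤ n)]
      rw [pow_succ', ← mul_assoc, div_mul_cancel₀ _ hρ.ne']
      exact (le_mul_of_one_le_right (abs_nonneg _) h1).trans h
  set S : ℝ → ℝ := fun t => ∑' n, coeff n T * t ^ n with hS
  set b : ℝ → ℝ := fun t => ∑' n, coeff n B * t ^ n
  set τ : ℝ := (gainA m K)⁻¹ with hτ
  have hτ0 : 0 < τ := inv_pos.2 hA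
  have hmem : ∀ t ∈ Set.Icc 0 τ, |t| < ρ⁻¹ := fun t ht => by
    rw [abs_of_nonneg ht.1]
    exact ht.2.trans_lt (inv_strictAnti₀ hρ hlt)
  have hconst : ∀ (a t : ℝ), ∑' n, coeff n (C a : ℝ⟦X⟧) * t ^ n = a := by
    intro a t
    rw [tsum_eq_single 0 (fun n hn => by simp [coeff_C, hn])]
    simp
  have hderiv : ∀ t ∈ Set.Icc 0 τ, HasDerivAt S (1 + m * b t) t := by
    intro t ht
    have h := hasDerivAt_tsum_coeff_mul_pow hρ hdT (hmem t ht)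
    have hs₁ := (summable_norm_coeff_mul_pow hρ hone (hmem t ht)).of_norm
    have hs₂ := (summable_norm_coeff_mul_pow hρ hB (hmem t ht)).of_norm.mul_left (m : ℝ)
    convert h using 1
    simp only [hT, map_add, coeff_C_mul, add_mul, mul_assoc]
    rw [hs₁.tsum_add hs₂, tsum_mul_left, ← map_one (C (R := ℝ)), hconst]
  have hmul : ∀ t ∈ Set.Icc 0 τ, b t * (1 - S t) = K := by
    intro t ht
    have hsB := summable_norm_coeff_mul_pow hρ hB (hmem t ht)
    have hsT := summable_norm_coeff_mul_pow hρ hTn (hmem t ht)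
    have h := tsum_coeff_mul_mul_pow hsB hsT
    have h' : ∑' n, coeff n (B - B * T) * t ^ n = K := by
      rw [show B - B * T = C K by linear_combination hBT, hconst]
    have hsBT : Summable fun n => coeff n (B * T) * t ^ n := by
      have : (fun n => coeff n (B * T) * t ^ n) =
          fun n => coeff n B * t ^ n - coeff n (C K : ℝ⟦X⟧) * t ^ n := by
        funext n
        rw [← sub_mul, ← map_sub, show B * T = B - C K by linear_combination -hBT]
      rw [this]
      refine hsB.of_norm.sub (summable_of_ne_finset_zero (s := {0}) fun n hn => ?_)
      simp [coeff_C, show n ≠ 0 by simpa using hn]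
    simp only [map_sub, sub_mul] at h'
    rw [hsB.of_norm.tsum_sub hsBT, h] at h'
    linear_combination h'
  have hS0 : S 0 = 0 := by
    simp only [hS]
    rw [tsum_eq_single 0 (fun n hn => by simp [hn])]
    simp [hT₀]
  have hScont : ContinuousOn S (Set.Icc 0 τ) := fun t ht =>
    (hderiv t ht).continuousAt.continuousWithinAt
  have hS1 : ∀ t ∈ Set.Icc 0 τ, S t < 1 := by
    intro t ht
    by_contra! hge
    obtain ⟨s, hs, hs1⟩ := intermediate_value_Icc ht.1
      (hScont.mono (Set.Icc_subset_Icc_right ht.2)) ⟨hS0.le.trans zero_le_one, hge⟩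
    have := hmul s ⟨hs.1, hs.2.trans ht.2⟩
    rw [hs1, sub_self, mul_zero] at this
    exact hK.ne this
  have hE : ∀ t ∈ Set.Icc 0 τ,
      HasDerivAt (fun t => S t + x * Real.log (1 + x - S t) - t) 0 t := by
    intro t ht
    have hpos : 0 < 1 + x - S t := by linarith [hS1 t ht]
    have h := ((hderiv t ht).add ((((hderiv t ht).const_sub (1 + x)).log hpos.ne').const_mul
      x)).sub (hasDerivAt_id t)
    refine h.congr_deriv ?_
    have hbt := hmul t ht
    have hne := hpos.ne'
    field_simp
    rw [hxdef]
    linear_combination (m : ℝ) * hbt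
  have hfin := constant_of_has_deriv_right_zero
    (fun t ht => (hE t ht).continuousAt.continuousWithinAt)
    (fun t ht => (hE t (Set.Ico_subset_Icc_self ht)).hasDerivWithinAt) τ ⟨hτ0.le, le_rfl⟩
  simp only [hS0, sub_zero, zero_add] at hfin
  have hτx : τ = 1 - x * Real.log (1 + 1 / x) := by
    rw [hτ, gainA, one_div, inv_inv, hxdef]
  have hlog : Real.log (1 + 1 / x) = Real.log (1 + x) - Real.log x := by
    rw [← Real.log_div (by positivity) hx.ne', add_div, div_self hx.ne', add_comm]
  have hu : 0 < 1 - S τ := by linarith [hS1 τ ⟨hτ0.le, le_rfl⟩]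
  have hlt' := Real.log_lt_sub_one_of_pos (x := (1 + x - S τ) / x)
    (div_pos (by linarith) hx) (by rw [Ne, div_eq_one_iff_eq hx.ne']; linarith)
  rw [Real.log_div (by linarith) hx.ne'] at hlt'
  have := mul_lt_mul_of_pos_left hlt' hx
  rw [mul_sub x ((1 + x - S τ) / x), mul_div_cancel₀ _ hx.ne'] at this
  rw [hlog] at hτx
  linarith

end Analytic

section Extremal

open PowerSeries

theorem derivative_rescale (M : ℝ) (f : ℝ⟦X⟧) :
    d⁄dX ℝ (rescale M f) = C M * rescale M (d⁄dX ℝ f) := by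
  ext n
  simp only [coeff_derivative, coeff_rescale, coeff_C_mul]
  ring

/-- The generating functions of `abs_modComp_le` as powers of a single series. -/
theorem powers_extremal_series {m : ℕ} {K M : ℝ} (hK : K ≠ 0) {B : ℝ⟦X⟧}
    (hB₀ : constantCoeff B = K) (hB : d⁄dX ℝ B = C K⁻¹ * B ^ 2 * (1 + C (m : ℝ) * B))
    {A : ℕ → ℝ⟦X⟧}
    (hA : A = fun k => C (k.factorial * (M / K) ^ k) * rescale M B ^ (k + 1)) :
    A 0 = rescale M B ∧ (∀ k, constantCoeff (A k) = K * M ^ k * k.factorial) ∧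
      ∀ k, d⁄dX ℝ (A k) = A (k + 1) + C (m : ℝ) * (A 0 * A (k + 1)) := by
  have hA0 : A 0 = rescale M B := by simp [hA]
  refine ⟨hA0, fun k => ?_, fun k => ?_⟩
  · have : constantCoeff (rescale M B) = K := by
      rw [← coeff_zero_eq_constantCoeff_apply, coeff_rescale]
      simp [hB₀]
    simp only [hA, map_mul, map_pow, this, constantCoeff_C, div_pow, pow_succ K]
    field_simp
  · have hR : ∀ a : ℝ, rescale M (C a : ℝ⟦X⟧) = C a := by
      intro a
      ext n
      rw [coeff_rescale, coeff_C]
      split_ifs with h <;> simp [h]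
    have hC : (C ((k + 1).factorial * (M / K) ^ (k + 1)) : ℝ⟦X⟧) =
        C (k.factorial * (M / K) ^ k) * ((k : ℝ⟦X⟧) + 1) * C M * C K⁻¹ := by
      rw [← map_natCast (C (R := ℝ)) k, ← map_one (C (R := ℝ)), ← map_add, ← map_mul, ← map_mul,
        ← map_mul, Nat.factorial_succ]
      congr 1
      push_cast
      ring
    rw [hA0]
    simp only [hA]
    rw [Derivation.leibniz, derivative_C, derivative_pow, derivative_rescale, hB, hC]
    simp only [map_mul, map_add, map_pow, map_one, hR, smul_eq_mul, Nat.add_sub_cancel,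
      Nat.cast_add, Nat.cast_one]
    ring

end Extremal

/-- if `|(c,η)| ≤ K_c M_c^{|η|} |η|!` for all `η`, then the
composition inverse satisfies `|(c⁻¹,η)| ≤ K (𝒜(K_c) M_c)^{|η|} |η|!` for some
`K > 0`; moreover no geometric growth constant smaller than `𝒜(K_c) M_c` works
for every series in the class with growth constants `K_c, M_c`.  In particular
`c⁻¹` is locally convergent. -/
theorem compositionInverse_localConvergence_radius (m : ℕ) (hm : 0 < m)
    (Kc Mc : ℝ) (hKc : 0 < Kc) (hMc : 0 < Mc) :
    (∀ c cinv : SeriesVec m m,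
      (∀ (η : Word m) (i : Fin m), |c i η| ≤ Kc * Mc ^ η.length * (Nat.factorial η.length : ℝ)) →
      cinv = modCompVec (-c) cinv →
      ∃ K : ℝ, 0 < K ∧ ∀ (η : Word m) (i : Fin m),
        |cinv i η| ≤ K * (gainA m Kc * Mc) ^ η.length * (Nat.factorial η.length : ℝ)) ∧
    (∀ M' : ℝ, 0 < M' → M' < gainA m Kc * Mc →
      ∃ c cinv : SeriesVec m m,
        (∀ (η : Word m) (i : Fin m),
          |c i η| ≤ Kc * Mc ^ η.length * (Nat.factorial η.length : ℝ)) ∧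
        cinv = modCompVec (-c) cinv ∧
        ¬ ∃ K : ℝ, 0 < K ∧ ∀ (η : Word m) (i : Fin m),
            |cinv i η| ≤ K * M' ^ η.length * (Nat.factorial η.length : ℝ)) := by
  obtain ⟨B, T, hB₀, hB, hT₀, hT, hBT, hgrowth⟩ := exists_extremal_series hm hKc
  obtain ⟨A, hAdef⟩ : ∃ A : ℕ → PowerSeries ℝ, A = fun k =>
    PowerSeries.C (k.factorial * (Mc / Kc) ^ k) * PowerSeries.rescale Mc B ^ (k + 1) := ⟨_, rfl⟩
  obtain ⟨hA0, hA₀, hA⟩ := powers_extremal_series (m := m) hKc.ne' hB₀ hB hAdef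
  have hm' : (0 : ℝ) < m := Nat.cast_pos.2 hm
  have hgain := gainA_pos hm hKc
  constructor
  · intro c cinv hc hcinv
    refine ⟨gainA m Kc / m, div_pos hgain hm', fun η i => ?_⟩
    have h := abs_modComp_le hA₀ hA (c := -c) (fun η i => by simpa using hc η i) hcinv 0 (-c i)
      (fun η => by simpa using hc η i) η
    have hi : modComp (-c i) cinv = cinv i := (congrFun hcinv i).symm
    rw [hi, hA0, PowerSeries.coeff_rescale] at h
    have hcoeff : PowerSeries.coeff η.length B ≤ gainA m Kc / m * gainA m Kc ^ η.length := by
      rw [div_mul_eq_mul_div, le_div_iff₀ hm', ← pow_succ', mul_comm]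
      exact hgrowth _
    calc |cinv i η| ≤ η.length.factorial * (Mc ^ η.length * PowerSeries.coeff η.length B) := h
      _ ≤ η.length.factorial *
          (Mc ^ η.length * (gainA m Kc / m * gainA m Kc ^ η.length)) := by gcongr
      _ = _ := by rw [mul_pow]; ring
  · intro M' hM' hlt
    obtain ⟨cinv, hcinv⟩ := exists_eq_modCompVec
      (fun (_ : Fin m) (η : Word m) => Kc * Mc ^ η.length * (η.length.factorial : ℝ))
    refine ⟨-fun _ η => Kc * Mc ^ η.length * η.length.factorial, cinv, ?_, ?_, ?_⟩
    · intro η i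
      rw [Pi.neg_apply, Pi.neg_apply, abs_neg, abs_of_nonneg (by positivity)]
    · rwa [neg_neg]
    · rintro ⟨K, -, hK⟩
      refine absurd (gainA_le_of_abs_coeff_le hm hKc hT₀ hT hBT (D := K) (div_pos hM' hMc)
        fun n => ?_) (not_le.2 ((div_lt_iff₀ hMc).2 hlt))
      have h := hK (List.replicate n 0) ⟨0, hm⟩
      have hval : cinv ⟨0, hm⟩ (List.replicate n 0) =
          n.factorial * (Mc ^ n * PowerSeries.coeff n B) := by
        rw [← PowerSeries.coeff_rescale, ← hA0, ← modComp_replicate_zero hA₀ hA hcinv 0 n]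
        exact congrFun (congrFun hcinv _) _
      have hfac : (0 : ℝ) < n.factorial := Nat.cast_pos.2 n.factorial_pos
      rw [hval, List.length_replicate, abs_mul, abs_of_pos hfac, mul_comm,
        mul_le_mul_iff_left₀ hfac, abs_mul, abs_of_pos (pow_pos hMc n)] at h
      rw [div_pow, mul_div_assoc', le_div_iff₀ (pow_pos hMc n), mul_comm]
      exact h
end
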